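/- Let Π_t be polynomials orthogonal with respect to the Marchenko–Pastur density μ_κ (satisfying Π_0 = 1, Π_1(x) = 1−x, Π_t(x) = (1+κ−x)Π_{t−1}(x) − κΠ_{t−2}(x)), and let ω > 0, c ∈ ℝ with Π_t(−ωc) ≠ 0 for all t. Define R_t(x) = Π_t(ω(x−c))/Π_t(−ωc). Then R_t(0) = 1, deg(R_t) = t, and the family {R_t} is orthogonal with respect to the density x·μ_τ(x)/(x−c) on [α, β], where μ_τ is the Marchenko–Pastur density with parameter τ, α = (1−√τ)², β = (1+√τ)², c < α, ω = 4/(√(β−c)+√(α−c))², and κ = ((√(β−c)−√(α−c))/(√(β−c)+√(α−c)))². -/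

import Mathlib

open Polynomial

/-- The Marchenko–Pastur density with parameter τ ∈ (0,1), supported on
[(1−√τ)², (1+√τ)²]. -/
noncomputable def mpDensity (τ x : ℝ) : ℝ :=
  Real.sqrt (((1 + Real.sqrt τ) ^ 2 - x) * (x - (1 - Real.sqrt τ) ^ 2)) /
    (2 * Real.pi * τ * x)

/-- Any linear functional annihilating `P n` for `n ≥ 1` makes a family with the
Marchenko–Pastur three-term recursion orthogonal. -/
lemma functional_mul_eq_zero_of_lt (L : ℝ[X] →ₗ[ℝ] ℝ) (κ : ℝ) (P : ℕ → ℝ[X])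
    (hP0 : P 0 = 1) (hP1 : P 1 = 1 - X)
    (hPrec : ∀ s, P (s + 2) = (C (1 + κ) - X) * P (s + 1) - C κ * P s)
    (hL : ∀ n, 1 ≤ n → L (P n) = 0) (l : ℕ) :
    ∀ k, l < k → L (P k * P l) = 0 := by
  induction l using Nat.strong_induction_on with
  | _ l ih =>
    rcases l with _ | _ | l
    · intro k hk
      simpa [hP0] using hL k hk
    · intro k hk
      obtain ⟨k, rfl⟩ : ∃ j, k = j + 2 := ⟨k - 2, by omega⟩
      have h : P (k + 2) * P 1 =
          P (k + 3) - κ • P (k + 2) + κ • P (k + 1) := by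
        rw [hPrec (k + 1), hP1]
        simp only [smul_eq_C_mul, C_add, C_1]
        ring
      rw [h]
      simp [hL]
    · intro k hk
      obtain ⟨k, rfl⟩ : ∃ j, k = j + 2 := ⟨k - 2, by omega⟩
      have h : P (k + 2) * P (l + 2) = P (k + 3) * P (l + 1)
          + κ • (P (k + 1) * P (l + 1)) - κ • (P (k + 2) * P l) := by
        rw [hPrec (k + 1), hPrec l]
        simp only [smul_eq_C_mul]
        ring
      rw [h]
      simp [ih (l + 1) (by omega) (k + 3) (by omega),
        ih (l + 1) (by omega) (k + 1) (by omega), ih l (by omega) (k + 2) (by omega)]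

lemma natDegree_of_marchenkoPastur_rec (κ : ℝ) (P : ℕ → ℝ[X])
    (hP0 : P 0 = 1) (hP1 : P 1 = 1 - X)
    (hPrec : ∀ s, P (s + 2) = (C (1 + κ) - X) * P (s + 1) - C κ * P s) (n : ℕ) :
    (P n).natDegree = n := by
  have key : ∀ n, (P n).natDegree ≤ n ∧ (P n).coeff n = (-1) ^ n := by
    intro n
    induction n using Nat.twoStepInduction with
    | zero => simp [hP0]
    | one =>
      rw [hP1]
      refine ⟨by compute_degree, by simp [coeff_one]⟩
    | more n ih0 ih1 =>
      rw [hPrec]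
      refine ⟨?_, ?_⟩
      · refine (natDegree_sub_le _ _).trans (max_le ?_ ?_)
        · refine natDegree_mul_le.trans ?_
          have : (C (1 + κ) - X : ℝ[X]).natDegree ≤ 1 := by compute_degree
          omega
        · exact (natDegree_C_mul_le _ _).trans (by omega)
      · have h1 : (P (n + 1)).coeff (n + 2) = 0 :=
          coeff_eq_zero_of_natDegree_lt (by omega)
        have h0 : (P n).coeff (n + 2) = 0 :=
          coeff_eq_zero_of_natDegree_lt (by omega)
        rw [coeff_sub, sub_mul, coeff_sub, coeff_C_mul, coeff_C_mul, coeff_X_mul, h1, h0, ih1.2]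
        ring
  exact le_antisymm (key n).1
    (le_natDegree_of_ne_zero (by rw [(key n).2]; positivity))

lemma sin_mul_eval_of_marchenkoPastur_rec (s : ℝ) (P : ℕ → ℝ[X])
    (hP0 : P 0 = 1) (hP1 : P 1 = 1 - X)
    (hPrec : ∀ n, P (n + 2) = (C (1 + s ^ 2) - X) * P (n + 1) - C (s ^ 2) * P n)
    (θ : ℝ) (n : ℕ) :
    Real.sin θ * (P n).eval (1 + s ^ 2 - 2 * s * Real.cos θ) =
      s ^ n * (Real.sin ((n + 1) * θ) - s * Real.sin (n * θ)) := by
  induction n using Nat.twoStepInduction with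
  | zero => simp [hP0]
  | one =>
    rw [hP1]
    simp only [eval_sub, eval_one, eval_X, Nat.cast_one, one_mul, pow_one]
    rw [one_add_one_eq_two, Real.sin_two_mul]
    ring
  | more n ih0 ih1 =>
    have e : Real.sin θ * (P (n + 2)).eval (1 + s ^ 2 - 2 * s * Real.cos θ) =
        2 * s * Real.cos θ *
          (Real.sin θ * (P (n + 1)).eval (1 + s ^ 2 - 2 * s * Real.cos θ)) -
        s ^ 2 * (Real.sin θ * (P n).eval (1 + s ^ 2 - 2 * s * Real.cos θ)) := by
      rw [hPrec]
      simp only [eval_sub, eval_mul, eval_C, eval_X]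
      ring
    rw [e, ih0, ih1]
    push_cast
    have a2 : ((n : ℝ) + 2) * θ = (n + 1) * θ + θ := by ring
    have a3 : ((n : ℝ) + 2 + 1) * θ = (n + 1) * θ + θ + θ := by ring
    have a2' : ((n : ℝ) + 1 + 1) * θ = (n + 1) * θ + θ := by ring
    have a0 : (n : ℝ) * θ = (n + 1) * θ - θ := by ring
    rw [a3, a2, a2', a0]
    simp only [Real.sin_add, Real.sin_sub, Real.cos_add]
    linear_combination s ^ (n + 2) * Real.sin ((n + 1) * θ) *
      Real.sin_sq_add_cos_sq θ

lemma integral_sin_mul_sin_eq_zero (n : ℕ) (hn : 1 ≤ n) :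
    ∫ θ in (0 : ℝ)..Real.pi, Real.sin ((n + 1) * θ) * Real.sin θ = 0 := by
  have h : ∀ m : ℕ, 1 ≤ m → ∫ θ in (0 : ℝ)..Real.pi, Real.cos (m * θ) = 0 := by
    intro m hm
    have hm' : (m : ℝ) ≠ 0 := by positivity
    rw [intervalIntegral.integral_comp_mul_left (fun x => Real.cos x) hm']
    simp [Real.sin_nat_mul_pi]
  have e : ∀ θ : ℝ, Real.sin ((n + 1) * θ) * Real.sin θ =
      (1 / 2) * (Real.cos (n * θ) - Real.cos ((n + 2 : ℕ) * θ)) := by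
    intro θ
    have a0 : (n : ℝ) * θ = (n + 1) * θ - θ := by ring
    have a2 : ((n + 2 : ℕ) : ℝ) * θ = (n + 1) * θ + θ := by push_cast; ring
    rw [a0, a2, Real.cos_add, Real.cos_sub]
    ring
  simp only [e]
  rw [intervalIntegral.integral_const_mul, intervalIntegral.integral_sub
    (Continuous.intervalIntegrable (by fun_prop) _ _)
    (Continuous.intervalIntegrable (by fun_prop) _ _), h n hn, h (n + 2) (by omega)]
  simp

lemma sq_one_sub_le_trig {s : ℝ} (hs0 : 0 ≤ s) (θ : ℝ) :
    (1 - s) ^ 2 ≤ 1 + s ^ 2 - 2 * s * Real.cos θ := by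
  nlinarith [Real.cos_le_one θ]

lemma trig_pos {s : ℝ} (hs0 : 0 ≤ s) (hs1 : s < 1) (θ : ℝ) :
    0 < 1 + s ^ 2 - 2 * s * Real.cos θ :=
  lt_of_lt_of_le (pow_pos (sub_pos.2 hs1) 2) (sq_one_sub_le_trig hs0 θ)

/-- The Marchenko–Pastur functional in the trigonometric parametrization
`y = 1 + s² - 2 s cos θ`, up to a constant factor. -/
noncomputable def trigFunctional (s : ℝ) (hs0 : 0 ≤ s) (hs1 : s < 1) : ℝ[X] →ₗ[ℝ] ℝ where
  toFun p := ∫ θ in (0 : ℝ)..Real.pi, p.eval (1 + s ^ 2 - 2 * s * Real.cos θ) *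
    (Real.sin θ ^ 2 / (1 + s ^ 2 - 2 * s * Real.cos θ))
  map_add' p q := by
    have hc : ∀ p : ℝ[X], Continuous fun θ : ℝ => p.eval (1 + s ^ 2 - 2 * s * Real.cos θ) *
        (Real.sin θ ^ 2 / (1 + s ^ 2 - 2 * s * Real.cos θ)) := fun p =>
      (p.continuous.comp (by fun_prop)).mul
        (Continuous.div (by fun_prop) (by fun_prop) fun θ => (trig_pos hs0 hs1 θ).ne')
    simp only [eval_add, add_mul]
    exact intervalIntegral.integral_add ((hc p).intervalIntegrable _ _)
      ((hc q).intervalIntegrable _ _)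
  map_smul' a p := by
    simp only [eval_smul, smul_eq_mul, mul_assoc, RingHom.id_apply]
    exact intervalIntegral.integral_const_mul _ _

lemma trigFunctional_eq_zero (s : ℝ) (hs0 : 0 ≤ s) (hs1 : s < 1) (P : ℕ → ℝ[X])
    (hP0 : P 0 = 1) (hP1 : P 1 = 1 - X)
    (hPrec : ∀ n, P (n + 2) = (C (1 + s ^ 2) - X) * P (n + 1) - C (s ^ 2) * P n)
    (n : ℕ) (hn : 1 ≤ n) : trigFunctional s hs0 hs1 (P n) = 0 := by
  have hsin := sin_mul_eval_of_marchenkoPastur_rec s P hP0 hP1 hPrec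
  have step : ∀ n, 1 ≤ n →
      trigFunctional s hs0 hs1 (P n) = trigFunctional s hs0 hs1 (P (n + 1)) := by
    intro n hn
    rw [← sub_eq_zero, ← map_sub]
    have e : ∀ θ : ℝ, (P n - P (n + 1)).eval (1 + s ^ 2 - 2 * s * Real.cos θ) *
        (Real.sin θ ^ 2 / (1 + s ^ 2 - 2 * s * Real.cos θ)) =
        s ^ n * (Real.sin ((n + 1) * θ) * Real.sin θ) := by
      intro θ
      have hD := (trig_pos hs0 hs1 θ).ne'
      have h0 := hsin θ n
      have h1 := hsin θ (n + 1)
      push_cast at h1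
      have a2 : ((n : ℝ) + 1 + 1) * θ = (n + 1) * θ + θ := by ring
      have a0 : (n : ℝ) * θ = (n + 1) * θ - θ := by ring
      rw [a0, Real.sin_sub] at h0
      rw [a2, Real.sin_add] at h1
      rw [mul_div_assoc', div_eq_iff hD, eval_sub]
      linear_combination Real.sin θ * h0 - Real.sin θ * h1
    change ∫ θ in (0 : ℝ)..Real.pi, _ = 0
    simp only [e]
    rw [intervalIntegral.integral_const_mul, integral_sin_mul_sin_eq_zero n hn, mul_zero]
  have bound : ∀ n, ‖trigFunctional s hs0 hs1 (P n)‖ ≤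
      s ^ n * (2 / (1 - s) ^ 2 * |Real.pi - 0|) := by
    intro n
    rw [← mul_assoc]
    refine intervalIntegral.norm_integral_le_of_norm_le_const fun θ _ => ?_
    have hD := trig_pos hs0 hs1 θ
    have e : (P n).eval (1 + s ^ 2 - 2 * s * Real.cos θ) *
        (Real.sin θ ^ 2 / (1 + s ^ 2 - 2 * s * Real.cos θ)) =
        s ^ n * ((Real.sin ((n + 1) * θ) - s * Real.sin (n * θ)) * Real.sin θ /
          (1 + s ^ 2 - 2 * s * Real.cos θ)) := by
      rw [mul_div_assoc', mul_div_assoc']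
      congr 1
      linear_combination Real.sin θ * hsin θ n
    rw [e, norm_mul, Real.norm_of_nonneg (pow_nonneg hs0 n), norm_div,
      Real.norm_of_nonneg hD.le]
    refine mul_le_mul_of_nonneg_left ?_ (pow_nonneg hs0 n)
    have hnum : ‖(Real.sin ((n + 1) * θ) - s * Real.sin (n * θ)) * Real.sin θ‖ ≤ 2 := by
      have h1 : ‖Real.sin ((n + 1) * θ) - s * Real.sin (n * θ)‖ ≤ 2 := by
        refine (norm_sub_le _ _).trans ?_
        rw [norm_mul, Real.norm_of_nonneg hs0, Real.norm_eq_abs, Real.norm_eq_abs]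
        nlinarith [Real.abs_sin_le_one ((n + 1) * θ), Real.abs_sin_le_one (n * θ),
          abs_nonneg (Real.sin (n * θ))]
      rw [norm_mul]
      have h2 : ‖Real.sin θ‖ ≤ 1 := Real.abs_sin_le_one θ
      nlinarith [norm_nonneg (Real.sin θ), norm_nonneg
        (Real.sin ((n + 1) * θ) - s * Real.sin (n * θ))]
    exact div_le_div₀ zero_le_two hnum (pow_pos (sub_pos.2 hs1) 2) (sq_one_sub_le_trig hs0 θ)
  have const : ∀ j, trigFunctional s hs0 hs1 (P (n + j)) = trigFunctional s hs0 hs1 (P n) := by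
    intro j
    induction j with
    | zero => rfl
    | succ j ih => rw [← ih, ← add_assoc, ← step (n + j) (by omega)]
  have hpow : Filter.Tendsto (fun j : ℕ => s ^ (n + j) * (2 / (1 - s) ^ 2 * |Real.pi - 0|))
      Filter.atTop (nhds 0) := by
    have h := (tendsto_pow_atTop_nhds_zero_of_lt_one hs0 hs1).mul_const
      (2 / (1 - s) ^ 2 * |Real.pi - 0|)
    rw [zero_mul] at h
    exact h.comp (Filter.tendsto_add_atTop_nat n |>.congr fun j => add_comm j n)
  have hle : ‖trigFunctional s hs0 hs1 (P n)‖ ≤ 0 :=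
    ge_of_tendsto' hpow fun j => const j ▸ bound (n + j)
  exact norm_le_zero_iff.1 hle

/-- The substitution `x = 1 + τ - 2 √τ cos θ` turns the modified Marchenko–Pastur weight into
the trigonometric functional. -/
lemma integral_mul_mpDensity_eq (τ c ω s : ℝ) (hτ0 : 0 < τ) (hτ1 : τ < 1)
    (hc : c < (1 - Real.sqrt τ) ^ 2) (hs0 : 0 ≤ s) (hs1 : s < 1)
    (h : ∀ z : ℝ, ω * ((1 + τ - 2 * Real.sqrt τ * z) - c) = 1 + s ^ 2 - 2 * s * z) (p : ℝ[X]) :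
    ∫ x in ((1 - Real.sqrt τ) ^ 2)..((1 + Real.sqrt τ) ^ 2),
      p.eval (ω * (x - c)) * (x * mpDensity τ x / (x - c)) =
    2 * ω / Real.pi * trigFunctional s hs0 hs1 p := by
  have hq : Real.sqrt τ ^ 2 = τ := Real.sq_sqrt hτ0.le
  have hq0 : 0 < Real.sqrt τ := Real.sqrt_pos.2 hτ0
  have hq1 : Real.sqrt τ < 1 := by nlinarith
  set q := Real.sqrt τ with hqdef
  have hαpos : 0 < (1 - q) ^ 2 := pow_pos (sub_pos.2 hq1) 2
  set f : ℝ → ℝ := fun θ => 1 + τ - 2 * q * Real.cos θ with hf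
  have hfge : ∀ θ, (1 - q) ^ 2 ≤ f θ := fun θ => by
    simp only [hf]
    nlinarith [Real.cos_le_one θ]
  have hf' : ∀ θ, HasDerivAt f (2 * q * Real.sin θ) θ := fun θ => by
    exact (((Real.hasDerivAt_cos θ).const_mul (2 * q)).const_sub (1 + τ)).congr_deriv (by ring)
  have hf0 : f 0 = (1 - q) ^ 2 := by simp only [hf, Real.cos_zero]; linear_combination -hq
  have hfπ : f Real.pi = (1 + q) ^ 2 := by simp only [hf, Real.cos_pi]; linear_combination -hq
  rw [← hf0, ← hfπ]
  rw [← intervalIntegral.integral_comp_mul_deriv'' (f' := fun θ => 2 * q * Real.sin θ)]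
  · change _ = 2 * ω / Real.pi * ∫ θ in (0 : ℝ)..Real.pi, _
    rw [← intervalIntegral.integral_const_mul]
    refine intervalIntegral.integral_congr fun θ hθ => ?_
    rw [Set.uIcc_of_le Real.pi_pos.le] at hθ
    have hsin : 0 ≤ Real.sin θ := Real.sin_nonneg_of_mem_Icc hθ
    have hsqrt : Real.sqrt (((1 + q) ^ 2 - f θ) * (f θ - (1 - q) ^ 2)) = 2 * q * Real.sin θ := by
      rw [← Real.sqrt_sq (by positivity : 0 ≤ 2 * q * Real.sin θ)]
      congr 1
      simp only [hf]
      rw [← hq, mul_pow, Real.sin_sq]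
      ring
    have hx : f θ ≠ 0 := (hαpos.trans_le (hfge θ)).ne'
    have hxc : f θ - c ≠ 0 := (sub_pos.2 (hc.trans_le (hfge θ))).ne'
    have hD := (trig_pos hs0 hs1 θ).ne'
    have hω : ω * (f θ - c) = 1 + s ^ 2 - 2 * s * Real.cos θ := h _
    simp only [Function.comp_apply, mpDensity, ← hqdef, hsqrt, hω]
    rw [← hω] at hD ⊢
    have hω0 : ω ≠ 0 := left_ne_zero_of_mul hD
    have hpi := Real.pi_ne_zero
    field_simp
    rw [← hq]
    ring
  · fun_prop
  · exact fun θ _ => (hf' θ).hasDerivWithinAt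
  · fun_prop
  · rintro _ ⟨θ, _, rfl⟩
    have hx : f θ ≠ 0 := (hαpos.trans_le (hfge θ)).ne'
    have hxc : f θ - c ≠ 0 := (sub_pos.2 (hc.trans_le (hfge θ))).ne'
    have hden : 2 * Real.pi * τ * f θ ≠ 0 := by positivity
    refine ContinuousAt.continuousWithinAt ?_
    refine (p.continuous.comp (by fun_prop)).continuousAt.mul ?_
    refine (continuousAt_id.mul ?_).div (by fun_prop) hxc
    unfold mpDensity
    exact ContinuousAt.div (Continuous.continuousAt (by fun_prop)) (by fun_prop) hden

/-- let τ ∈ (0,1), α = (1−√τ)², β = (1+√τ)², c < α,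
ω = 4/(√(β−c)+√(α−c))², κ = ((√(β−c)−√(α−c))/(√(β−c)+√(α−c)))², and let {Π_t} be
the orthogonal polynomials of the Marchenko–Pastur density μ_κ (via the three-term
recursion), with Π_t(−ωc) ≠ 0. Then R_t(x) = Π_t(ω(x−c))/Π_t(−ωc) satisfies
R_t(0) = 1, deg R_t = t, and {R_t} is orthogonal w.r.t. the density
x·μ_τ(x)/(x−c) on [α,β]. -/
theorem stmt_19 (τ c : ℝ) (hτ0 : 0 < τ) (hτ1 : τ < 1)
    (hc : c < (1 - Real.sqrt τ) ^ 2)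
    (ω κ : ℝ)
    (hω : ω = 4 / (Real.sqrt ((1 + Real.sqrt τ) ^ 2 - c) +
      Real.sqrt ((1 - Real.sqrt τ) ^ 2 - c)) ^ 2)
    (hκ : κ = ((Real.sqrt ((1 + Real.sqrt τ) ^ 2 - c) -
          Real.sqrt ((1 - Real.sqrt τ) ^ 2 - c)) /
        (Real.sqrt ((1 + Real.sqrt τ) ^ 2 - c) +
          Real.sqrt ((1 - Real.sqrt τ) ^ 2 - c))) ^ 2)
    (P : ℕ → Polynomial ℝ)
    (hP0 : P 0 = 1) (hP1 : P 1 = 1 - Polynomial.X)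
    (hPrec : ∀ s, P (s + 2) =
      (Polynomial.C (1 + κ) - Polynomial.X) * P (s + 1) - Polynomial.C κ * P s)
    (hnz : ∀ s, (P s).eval (-(ω * c)) ≠ 0)
    (R : ℕ → Polynomial ℝ)
    (hR : ∀ s, R s = Polynomial.C ((P s).eval (-(ω * c)))⁻¹ *
      (P s).comp (Polynomial.C ω * (Polynomial.X - Polynomial.C c))) :
    (∀ s, (R s).eval 0 = 1) ∧ (∀ s, (R s).natDegree = s) ∧
    (∀ k l, k ≠ l →
      (∫ x in ((1 - Real.sqrt τ) ^ 2)..((1 + Real.sqrt τ) ^ 2),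
        (R k).eval x * (R l).eval x * (x * mpDensity τ x / (x - c))) = 0) := by
  have hq : Real.sqrt τ ^ 2 = τ := Real.sq_sqrt hτ0.le
  have hq0 : 0 < Real.sqrt τ := Real.sqrt_pos.2 hτ0
  have hA2 : Real.sqrt ((1 + Real.sqrt τ) ^ 2 - c) ^ 2 = (1 + Real.sqrt τ) ^ 2 - c :=
    Real.sq_sqrt (by nlinarith)
  have hB2 : Real.sqrt ((1 - Real.sqrt τ) ^ 2 - c) ^ 2 = (1 - Real.sqrt τ) ^ 2 - c :=
    Real.sq_sqrt (by linarith)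
  have hB0 : 0 < Real.sqrt ((1 - Real.sqrt τ) ^ 2 - c) := Real.sqrt_pos.2 (by linarith)
  have hAB : Real.sqrt ((1 - Real.sqrt τ) ^ 2 - c) < Real.sqrt ((1 + Real.sqrt τ) ^ 2 - c) :=
    Real.sqrt_lt_sqrt (by linarith) (by nlinarith)
  set A := Real.sqrt ((1 + Real.sqrt τ) ^ 2 - c)
  set B := Real.sqrt ((1 - Real.sqrt τ) ^ 2 - c)
  have hAB0 : 0 < A + B := by linarith
  have hω0 : ω ≠ 0 := by rw [hω]; positivity
  obtain ⟨s, hs⟩ : ∃ s, s = (A - B) / (A + B) := ⟨_, rfl⟩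
  have hs0 : 0 ≤ s := by rw [hs]; exact div_nonneg (by linarith) hAB0.le
  have hs1 : s < 1 := by rw [hs, div_lt_one hAB0]; linarith
  rw [← hs] at hκ
  subst hκ
  have hlin : ∀ z : ℝ,
      ω * ((1 + τ - 2 * Real.sqrt τ * z) - c) = 1 + s ^ 2 - 2 * s * z := by
    intro z
    have hmid : 1 + τ - c = (A ^ 2 + B ^ 2) / 2 := by rw [hA2, hB2]; linear_combination -hq
    have hrad : Real.sqrt τ = (A ^ 2 - B ^ 2) / 4 := by rw [hA2, hB2]; ring
    rw [show 1 + τ - 2 * Real.sqrt τ * z - c = (1 + τ - c) - 2 * Real.sqrt τ * z by ring,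
      hmid, hrad, hω, hs]
    field_simp
    ring
  have hdeg := natDegree_of_marchenkoPastur_rec (s ^ 2) P hP0 hP1 hPrec
  have horth : ∀ k l, l < k → trigFunctional s hs0 hs1 (P k * P l) = 0 := fun k l =>
    functional_mul_eq_zero_of_lt _ (s ^ 2) P hP0 hP1 hPrec
      (trigFunctional_eq_zero s hs0 hs1 P hP0 hP1 hPrec) l k
  have heval : ∀ n x, (R n).eval x = ((P n).eval (-(ω * c)))⁻¹ * (P n).eval (ω * (x - c)) := by
    intro n x
    simp [hR]
  refine ⟨fun n => ?_, fun n => ?_, fun k l hkl => ?_⟩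
  · rw [heval, show ω * (0 - c) = -(ω * c) by ring]
    exact inv_mul_cancel₀ (hnz n)
  · rw [hR, natDegree_C_mul (inv_ne_zero (hnz n)), natDegree_comp, hdeg, natDegree_C_mul hω0,
      natDegree_X_sub_C, mul_one]
  · have e : ∀ x, (R k).eval x * (R l).eval x * (x * mpDensity τ x / (x - c)) =
        ((P k).eval (-(ω * c)))⁻¹ * ((P l).eval (-(ω * c)))⁻¹ *
          ((P k * P l).eval (ω * (x - c)) * (x * mpDensity τ x / (x - c))) := by
      intro x
      rw [heval, heval, eval_mul]
      ring
    simp only [e]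
    rw [intervalIntegral.integral_const_mul,
      integral_mul_mpDensity_eq τ c ω s hτ0 hτ1 hc hs0 hs1 hlin]
    have : trigFunctional s hs0 hs1 (P k * P l) = 0 := by
      rcases lt_or_gt_of_ne hkl with h | h
      · rw [mul_comm]; exact horth l k h
      · exact horth k l h
    rw [this, mul_zero, mul_zero]
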